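/- Consider regular 16-run designs with two four-level factors and one two-level factor (regular 4^2 2^1 designs) of resolution at least III, represented by two-dimensional subspaces U_1, U_2 of (ZMod 2)^4 with U_1 ∩ U_2 = {0} (so (ZMod 2)^4 = U_1 ⊕ U_2) together with a vector w ∈ (ZMod 2)^4 not belonging to U_1 ∪ U_2. Call two such designs isomorphic if there exist g ∈ GL(4, ZMod 2) and a permutation τ of {1, 2} with g(U_t) = U'_{τ(t)} for t = 1, 2 and g(w) = w'. Then there is exactly 1 isomorphism class of such designs. -/

import Mathlib

/-- A regular 16-run design with two four-level factors and `n` two-level factors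
(a regular `4^2 2^{n-p}` design) of resolution at least III: two-dimensional subspaces
`U 0, U 1` of `(ZMod 2)^4` intersecting only in `0` (so `(ZMod 2)^4 = U 0 ⊕ U 1`),
together with pairwise distinct vectors `w i` belonging to neither `U 0` nor `U 1`. -/
def FTL2Design (n : ℕ) : Type :=
  {Uw : (Fin 2 → Submodule (ZMod 2) (Fin 4 → ZMod 2)) × (Fin n → Fin 4 → ZMod 2) //
    (∀ t, Module.finrank (ZMod 2) (Uw.1 t) = 2) ∧
      Uw.1 0 ⊓ Uw.1 1 = ⊥ ∧
      Function.Injective Uw.2 ∧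
      ∀ i, Uw.2 i ∉ Uw.1 0 ∧ Uw.2 i ∉ Uw.1 1}

/-- Isomorphism of regular `4^2 2^{n-p}` designs: a linear automorphism `g` of
`(ZMod 2)^4`, a permutation `τ` of the two subspaces and a permutation `σ` of the
two-level factors with `g (U t) = U' (τ t)` and `g (w i) = w' (σ i)` for all `t, i`. -/
def FTL2DesignIso {n : ℕ} (D D' : FTL2Design n) : Prop :=
  ∃ (g : (Fin 4 → ZMod 2) ≃ₗ[ZMod 2] (Fin 4 → ZMod 2)) (τ : Equiv.Perm (Fin 2))
      (σ : Equiv.Perm (Fin n)),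
    (∀ t, Submodule.map g.toLinearMap (D.1.1 t) = D'.1.1 (τ t)) ∧
      ∀ i, g (D.1.2 i) = D'.1.2 (σ i)

/-- Two spaces of the same finite dimension are related by a linear equivalence that sends a
given nonzero vector to a given nonzero vector. -/
theorem LinearEquiv.exists_apply_eq_of_finrank_eq {K V W : Type*} [Field K]
    [AddCommGroup V] [Module K V] [FiniteDimensional K V]
    [AddCommGroup W] [Module K W] [FiniteDimensional K W]
    (h : Module.finrank K V = Module.finrank K W) {v : V} (hv : v ≠ 0) {w : W} (hw : w ≠ 0) :
    ∃ e : V ≃ₗ[K] W, e v = w := by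
  let e := LinearEquiv.ofFinrankEq V W h
  have hev : e v ≠ 0 := by simpa using hv
  obtain ⟨g, hg⟩ := Submodule.exists_linearEquiv_restrict_eq
    ((LinearEquiv.toSpanNonzeroSingleton K W (e v) hev).symm ≪≫ₗ
      LinearEquiv.toSpanNonzeroSingleton K W w hw)
  refine ⟨e ≪≫ₗ g, ?_⟩
  have hgv := hg (LinearEquiv.toSpanNonzeroSingleton K W (e v) hev 1)
  rw [LinearEquiv.trans_apply, LinearEquiv.symm_apply_apply,
    LinearEquiv.toSpanNonzeroSingleton_apply, LinearEquiv.toSpanNonzeroSingleton_apply] at hgv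
  simpa using hgv.symm

/-- Let `p`, `q` and `p'`, `q'` be two pairs of complementary subspaces with matching dimensions.
If `w ∉ p ∪ q` and `w' ∉ p' ∪ q'`, then some linear automorphism sends `p` to `p'`, `q` to `q'`
and `w` to `w'`. -/
theorem Submodule.exists_linearEquiv_map_eq_of_isCompl {K V : Type*} [Field K]
    [AddCommGroup V] [Module K V] [FiniteDimensional K V] {p q p' q' : Submodule K V}
    (h : IsCompl p q) (h' : IsCompl p' q')
    (hp : Module.finrank K p = Module.finrank K p') (hq : Module.finrank K q = Module.finrank K q')
    {w w' : V} (hwp : w ∉ p) (hwq : w ∉ q) (hwp' : w' ∉ p') (hwq' : w' ∉ q') :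
    ∃ g : V ≃ₗ[K] V, p.map g.toLinearMap = p' ∧ q.map g.toLinearMap = q' ∧ g w = w' := by
  obtain ⟨e, he⟩ := LinearEquiv.exists_apply_eq_of_finrank_eq hp
    (mt (prodEquivOfIsCompl_symm_apply_fst_eq_zero _ _ h).1 hwq)
    (mt (prodEquivOfIsCompl_symm_apply_fst_eq_zero _ _ h').1 hwq')
  obtain ⟨f, hf⟩ := LinearEquiv.exists_apply_eq_of_finrank_eq hq
    (mt (prodEquivOfIsCompl_symm_apply_snd_eq_zero _ _ h).1 hwp)
    (mt (prodEquivOfIsCompl_symm_apply_snd_eq_zero _ _ h').1 hwp')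
  let g : V ≃ₗ[K] V :=
    (prodEquivOfIsCompl p q h).symm ≪≫ₗ e.prodCongr f ≪≫ₗ prodEquivOfIsCompl p' q' h'
  have hgp (x : p) : g x = e x := by simp [g, prodEquivOfIsCompl_symm_apply_left p q h]
  have hgq (x : q) : g x = f x := by simp [g, prodEquivOfIsCompl_symm_apply_right p q h]
  refine ⟨g, eq_of_le_of_finrank_eq ?_ ?_, eq_of_le_of_finrank_eq ?_ ?_, ?_⟩
  · rintro _ ⟨x, hx, rfl⟩
    exact (hgp ⟨x, hx⟩).symm ▸ (e ⟨x, hx⟩).2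
  · exact (LinearEquiv.finrank_map_eq g p).trans hp
  · rintro _ ⟨x, hx, rfl⟩
    exact (hgq ⟨x, hx⟩).symm ▸ (f ⟨x, hx⟩).2
  · exact (LinearEquiv.finrank_map_eq g q).trans hq
  · rw [← (prodEquivOfIsCompl p' q' h').apply_symm_apply w', ← LinearEquiv.symm_apply_eq]
    exact Prod.ext (by simpa [g] using he) (by simpa [g] using hf)

/-- The four-level factors of a design span complementary subspaces. -/
theorem FTL2Design.isCompl {n : ℕ} (D : FTL2Design n) : IsCompl (D.1.1 0) (D.1.1 1) := by
  obtain ⟨hrank, hinf, -⟩ := D.2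
  exact (Submodule.isCompl_iff_disjoint _ _ (by simp [hrank])).2 (disjoint_iff.2 hinf)

/-- Any two designs with a single two-level factor are isomorphic. -/
theorem FTL2Design.iso_of_one (D D' : FTL2Design 1) : FTL2DesignIso D D' := by
  obtain ⟨hrank, -, -, hw⟩ := D.2
  obtain ⟨hrank', -, -, hw'⟩ := D'.2
  obtain ⟨g, h0, h1, hg⟩ := Submodule.exists_linearEquiv_map_eq_of_isCompl D.isCompl D'.isCompl
    ((hrank 0).trans (hrank' 0).symm) ((hrank 1).trans (hrank' 1).symm)
    (hw 0).1 (hw 0).2 (hw' 0).1 (hw' 0).2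
  exact ⟨g, 1, 1, Fin.forall_fin_two.2 ⟨h0, h1⟩, Fin.forall_fin_one.2 hg⟩

/-- The vectors vanishing on the range of an injection `Fin m → Fin n` form a subspace of
dimension `n - m`. -/
theorem finrank_ker_funLeft {K : Type*} [Field K] {m n : ℕ} {f : Fin m → Fin n}
    (hf : Function.Injective f) :
    Module.finrank K (LinearMap.ker (LinearMap.funLeft K K f)) = n - m := by
  have h := LinearMap.finrank_range_add_finrank_ker (LinearMap.funLeft K K f)
  rw [LinearMap.range_eq_top.2 (LinearMap.funLeft_surjective_of_injective K K f hf),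
    finrank_top, Module.finrank_fin_fun, Module.finrank_fin_fun] at h
  omega

/-- The subspaces `x₂ = x₃ = 0` and `x₀ = x₁ = 0` together with the all-ones vector form a
design. -/
theorem FTL2Design.nonempty_one : Nonempty (FTL2Design 1) := by
  refine ⟨⟨(![LinearMap.ker (LinearMap.funLeft _ _ ![2, 3]),
    LinearMap.ker (LinearMap.funLeft _ _ ![0, 1])], fun _ => 1), ?_, ?_, ?_, fun _ => ⟨?_, ?_⟩⟩⟩
  · exact Fin.forall_fin_two.2 ⟨finrank_ker_funLeft (by decide), finrank_ker_funLeft (by decide)⟩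
  · refine (Submodule.eq_bot_iff _).2 fun x ⟨h, h'⟩ => ?_
    have h2 := congrFun h 0
    have h3 := congrFun h 1
    have h0 := congrFun h' 0
    have h1 := congrFun h' 1
    ext i
    fin_cases i
    exacts [h0, h1, h2, h3]
  · exact Function.injective_of_subsingleton _
  · exact fun h => one_ne_zero (congrFun h 0)
  · exact fun h => one_ne_zero (congrFun h 0)

/-- There is exactly 1 isomorphism class of regular 16-run `4^2 2^1` designs of
resolution at least III: there is a design such that every design is isomorphic to it. -/
theorem one_isoClass_of_four_two_two_one :
    ∃ rep : FTL2Design 1, ∀ D : FTL2Design 1, FTL2DesignIso D rep :=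
  FTL2Design.nonempty_one.elim fun rep => ⟨rep, fun D => D.iso_of_one rep⟩
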